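/- Information-gain form of the generalized Schumacher–Westmoreland–Wootters inequality (eq. (3.39)): I_q{η; I} ≥ I_c + Σ_{α : p_α > 0} p_α·I_q{ρ_α; I}, i.e. the quantum information gain of the instrument at the average state dominates the classical mutual information plus the average quantum information gain at the letter states. -/

import Mathlib

open Matrix BigOperators
open scoped Kronecker ComplexOrder

noncomputable section

/-- A density matrix: positive semidefinite with unit trace. -/
def IsDensityMatrix {ι : Type*} [Fintype ι] (ρ : Matrix ι ι ℂ) : Prop :=
  ρ.PosSemidef ∧ ρ.trace = 1

/-- von Neumann entropy (natural logarithm), via the eigenvalues;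
junk value `0` if the matrix is not Hermitian. -/
noncomputable def vnEntropy {ι : Type*} [Fintype ι] [DecidableEq ι]
    (ρ : Matrix ι ι ℂ) : ℝ :=
  if h : ρ.IsHermitian then -∑ i, h.eigenvalues i * Real.log (h.eigenvalues i) else 0

/-- Quantum relative entropy `S(σ|τ)` (natural logarithm), computed in an orthonormal
eigenbasis of `τ`; junk value `0` if `σ` or `τ` is not Hermitian. -/
noncomputable def relEnt {ι : Type*} [Fintype ι] [DecidableEq ι]
    (σ τ : Matrix ι ι ℂ) : ℝ :=
  if h : σ.IsHermitian ∧ τ.IsHermitian then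
    (∑ i, h.1.eigenvalues i * Real.log (h.1.eigenvalues i))
      - ∑ j, (if 0 < h.2.eigenvalues j then
          Real.log (h.2.eigenvalues j) *
            ((star (fun i => h.2.eigenvectorBasis j i)) ⬝ᵥ
              σ.mulVec (fun i => h.2.eigenvectorBasis j i)).re
        else 0)
  else 0

/-- Holevo χ-quantity of an ensemble of states, relative to its barycenter. -/
noncomputable def holevoChi {ι B : Type*} [Fintype ι] [DecidableEq ι] [Fintype B]
    (q : B → ℝ) (τ : B → Matrix ι ι ℂ) : ℝ :=
  ∑ β, if 0 < q β then q β * relEnt (τ β) (∑ γ, q γ • τ γ) else 0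

/-- The action of an instrument in Kraus form: `I_ω(ρ) = ∑ k, V ω k * ρ * (V ω k)ᴴ`. -/
noncomputable def instAct {n m : ℕ} {Ω K : Type*} [Fintype K]
    (V : Ω → K → Matrix (Fin m) (Fin n) ℂ) (ω : Ω)
    (ρ : Matrix (Fin n) (Fin n) ℂ) : Matrix (Fin m) (Fin m) ℂ :=
  ∑ k, V ω k * ρ * (V ω k)ᴴ

/-- The POVM associated with an instrument in Kraus form: `E_ω = ∑ k, (V ω k)ᴴ * V ω k`. -/
noncomputable def povm {n m : ℕ} {Ω K : Type*} [Fintype K]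
    (V : Ω → K → Matrix (Fin m) (Fin n) ℂ) (ω : Ω) : Matrix (Fin n) (Fin n) ℂ :=
  ∑ k, (V ω k)ᴴ * V ω k

/-- Outcome probability `Tr(E_ω ρ)`. -/
noncomputable def probOut {n m : ℕ} {Ω K : Type*} [Fintype K]
    (V : Ω → K → Matrix (Fin m) (Fin n) ℂ) (ρ : Matrix (Fin n) (Fin n) ℂ) (ω : Ω) : ℝ :=
  ((povm V ω * ρ).trace).re

/-- The a posteriori state `π_ρ(ω) = I_ω(ρ)/Tr(I_ω(ρ))` (junk if the trace vanishes). -/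
noncomputable def post {n m : ℕ} {Ω K : Type*} [Fintype K]
    (V : Ω → K → Matrix (Fin m) (Fin n) ℂ) (ω : Ω)
    (ρ : Matrix (Fin n) (Fin n) ℂ) : Matrix (Fin m) (Fin m) ℂ :=
  (((instAct V ω ρ).trace.re)⁻¹ : ℝ) • instAct V ω ρ

/-- The classical (Shannon) input/output mutual information of the ensemble `(p, ρ)`
measured with the POVM of the instrument `V`. -/
noncomputable def Ic {n m : ℕ} {A Ω K : Type*} [Fintype A] [Fintype Ω] [Fintype K]
    (p : A → ℝ) (ρ : A → Matrix (Fin n) (Fin n) ℂ)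
    (V : Ω → K → Matrix (Fin m) (Fin n) ℂ) : ℝ :=
  ∑ α, ∑ ω,
    if 0 < p α * probOut V (ρ α) ω then
      p α * probOut V (ρ α) ω *
        Real.log ((p α * probOut V (ρ α) ω) /
          (p α * probOut V (∑ β, p β • ρ β) ω))
    else 0

/-- Quantum information gain of the instrument `V` at the state `ρ`. -/
noncomputable def infoGain {n m : ℕ} {Ω K : Type*} [Fintype Ω] [Fintype K]
    (V : Ω → K → Matrix (Fin m) (Fin n) ℂ) (ρ : Matrix (Fin n) (Fin n) ℂ) : ℝ :=
  vnEntropy ρ - ∑ ω, if 0 < (instAct V ω ρ).trace.re then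
    (instAct V ω ρ).trace.re * vnEntropy (post V ω ρ) else 0


open Filter Topology in
/-- Integrating a resolvent-type inequality over the parameter `T` gives a logarithmic one. -/
theorem sum_mul_log_sub_log_nonneg {ι : Type*} [Fintype ι] (c a b : ι → ℝ)
    (hc : ∑ i, c i = 0) (hpos : ∀ i, c i ≠ 0 → 0 < a i ∧ 0 < b i)
    (h : ∀ T : ℝ, 0 < T → 0 ≤ ∑ i, c i * (a i / (b i + T * a i))) :
    0 ≤ ∑ i, c i * (Real.log (a i) - Real.log (b i)) := by
  set g : ℝ → ℝ := fun T => ∑ i, c i * Real.log (b i + T * a i) with hg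
  have hder : ∀ T : ℝ, 0 ≤ T →
      HasDerivAt g (∑ i, c i * (a i / (b i + T * a i))) T := by
    intro T hT
    refine HasDerivAt.fun_sum fun i _ => ?_
    by_cases hi : c i = 0
    · simpa [hi] using hasDerivAt_const T (0 : ℝ)
    · obtain ⟨ha, hb⟩ := hpos i hi
      have h1 : HasDerivAt (fun T : ℝ => b i + T * a i) (a i) T := by
        simpa using ((hasDerivAt_id T).mul_const (a i)).const_add (b i)
      exact (h1.log (by positivity)).const_mul (c i)
  have hmono : MonotoneOn g (Set.Ici 0) := by
    refine monotoneOn_of_deriv_nonneg (convex_Ici 0)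
      (fun T hT => (hder T hT).continuousAt.continuousWithinAt)
      (fun T hT => ?_) (fun T hT => ?_)
    · rw [interior_Ici] at hT
      exact (hder T (le_of_lt hT)).differentiableAt.differentiableWithinAt
    · rw [interior_Ici] at hT
      rw [(hder T (le_of_lt hT)).deriv]
      exact h T hT
  have hlim : Tendsto g atTop (𝓝 (∑ i, c i * Real.log (a i))) := by
    have h1 : Tendsto (fun T : ℝ => ∑ i, c i * Real.log (b i / T + a i)) atTop
        (𝓝 (∑ i, c i * Real.log (a i))) := by
      refine tendsto_finsetSum _ fun i _ => ?_
      by_cases hi : c i = 0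
      · simp [hi]
      · obtain ⟨ha, hb⟩ := hpos i hi
        have h2 : Tendsto (fun T : ℝ => b i / T + a i) atTop (𝓝 (a i)) := by
          simpa using (tendsto_const_nhds.div_atTop tendsto_id).add_const (a i)
        exact (h2.log ha.ne').const_mul (c i)
    refine h1.congr' ?_
    filter_upwards [eventually_gt_atTop (0 : ℝ)] with T hT
    have h3 : ∀ i, c i * Real.log (b i / T + a i)
        = c i * Real.log (b i + T * a i) - c i * Real.log T := by
      intro i
      by_cases hi : c i = 0
      · simp [hi]
      · obtain ⟨ha, hb⟩ := hpos i hi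
        have : b i / T + a i = (b i + T * a i) / T := by field_simp
        rw [this, Real.log_div (by positivity) hT.ne']
        ring
    simp_rw [h3, Finset.sum_sub_distrib, ← Finset.sum_mul, hc]
    simp [hg]
  have h0 : g 0 ≤ ∑ i, c i * Real.log (a i) := by
    refine ge_of_tendsto hlim ?_
    filter_upwards [eventually_ge_atTop (0 : ℝ)] with T hT
    exact hmono (Set.mem_Ici.2 le_rfl) (Set.mem_Ici.2 hT) hT
  simp only [hg, zero_mul, add_zero] at h0
  simp_rw [mul_sub, Finset.sum_sub_distrib]
  linarith

section Hermitian

variable {ι : Type*} [Fintype ι] [DecidableEq ι] {A B : Matrix ι ι ℂ}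

theorem Matrix.IsHermitian.eq_mul_diagonal_mul_star (hA : A.IsHermitian) :
    A = (hA.eigenvectorUnitary : Matrix ι ι ℂ) *
      diagonal (fun i => (hA.eigenvalues i : ℂ)) *
      star (hA.eigenvectorUnitary : Matrix ι ι ℂ) := by
  conv_lhs => rw [hA.spectral_theorem, Unitary.conjStarAlgAut_apply]
  rfl

theorem Matrix.IsHermitian.cfc_eq_mul_diagonal_mul_star (hA : A.IsHermitian) (f : ℝ → ℝ) :
    cfc f A = (hA.eigenvectorUnitary : Matrix ι ι ℂ) *
      diagonal (fun i => (f (hA.eigenvalues i) : ℂ)) *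
      star (hA.eigenvectorUnitary : Matrix ι ι ℂ) := by
  rw [hA.cfc_eq, Matrix.IsHermitian.cfc, Unitary.conjStarAlgAut_apply]
  rfl

theorem Matrix.IsHermitian.trace_cfc_re (hA : A.IsHermitian) (f : ℝ → ℝ) :
    (cfc f A).trace.re = ∑ i, f (hA.eigenvalues i) := by
  rw [hA.cfc_eq_mul_diagonal_mul_star, trace_mul_comm, ← mul_assoc,
    Unitary.coe_star_mul_self, one_mul, trace_diagonal]
  simp

theorem Matrix.IsHermitian.eigenvectorUnitary_mul_star (hA : A.IsHermitian) :
    (hA.eigenvectorUnitary : Matrix ι ι ℂ) * star (hA.eigenvectorUnitary : Matrix ι ι ℂ) = 1 :=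
  Unitary.coe_mul_star_self _

/-- The change-of-basis matrix between the eigenbases of two Hermitian matrices. -/
def eigenTransition (hA : A.IsHermitian) (hB : B.IsHermitian) : Matrix ι ι ℂ :=
  star (hB.eigenvectorUnitary : Matrix ι ι ℂ) * (hA.eigenvectorUnitary : Matrix ι ι ℂ)

/-- Squared overlap of the `i`-th eigenvector of `A` and the `j`-th eigenvector of `B`. -/
def eigenOverlap (hA : A.IsHermitian) (hB : B.IsHermitian) (i j : ι) : ℝ :=
  Complex.normSq (eigenTransition hA hB j i)

theorem eigenOverlap_nonneg (hA : A.IsHermitian) (hB : B.IsHermitian) (i j : ι) :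
    0 ≤ eigenOverlap hA hB i j := Complex.normSq_nonneg _

theorem sum_eigenOverlap (hA : A.IsHermitian) (hB : B.IsHermitian) (i : ι) :
    ∑ j, eigenOverlap hA hB i j = 1 := by
  have h : star (eigenTransition hA hB) * eigenTransition hA hB = 1 := by
    unfold eigenTransition
    rw [star_mul, star_star, mul_assoc,
      ← mul_assoc (hB.eigenvectorUnitary : Matrix ι ι ℂ), hB.eigenvectorUnitary_mul_star, one_mul,
      Unitary.coe_star_mul_self]
  have h2 := congrArg Complex.re (congrFun (congrFun h i) i)
  simpa [Matrix.mul_apply, eigenOverlap, Complex.normSq_apply] using h2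

theorem diag_eigenbasis (hA : A.IsHermitian) (hB : B.IsHermitian) (j : ι) :
    ((star (hB.eigenvectorUnitary : Matrix ι ι ℂ) * A *
      (hB.eigenvectorUnitary : Matrix ι ι ℂ)) j j).re
      = ∑ i, eigenOverlap hA hB i j * hA.eigenvalues i := by
  have h : star (hB.eigenvectorUnitary : Matrix ι ι ℂ) * A *
      (hB.eigenvectorUnitary : Matrix ι ι ℂ) =
      eigenTransition hA hB * diagonal (fun i => (hA.eigenvalues i : ℂ)) *
        star (eigenTransition hA hB) := by
    conv_lhs => rw [hA.eq_mul_diagonal_mul_star]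
    simp [eigenTransition, mul_assoc]
  rw [h, Matrix.mul_apply, Complex.re_sum]
  refine Finset.sum_congr rfl fun i _ => ?_
  simp [Matrix.mul_diagonal, eigenOverlap, Complex.normSq_apply]
  ring

theorem diag_eigenbasis_self (hB : B.IsHermitian) (j : ι) :
    (star (hB.eigenvectorUnitary : Matrix ι ι ℂ) * B *
      (hB.eigenvectorUnitary : Matrix ι ι ℂ)) j j = (hB.eigenvalues j : ℂ) := by
  have h : star (hB.eigenvectorUnitary : Matrix ι ι ℂ) * B *
      (hB.eigenvectorUnitary : Matrix ι ι ℂ) = diagonal (fun i => (hB.eigenvalues i : ℂ)) := by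
    conv_lhs =>
      enter [1, 2]
      rw [hB.eq_mul_diagonal_mul_star]
    rw [mul_assoc, mul_assoc, mul_assoc, Unitary.coe_star_mul_self, mul_one, ← mul_assoc,
      Unitary.coe_star_mul_self, one_mul]
  rw [h, diagonal_apply_eq]

/-- If `A` is dominated by a multiple of `B`, then eigenvectors of `A` with positive eigenvalue
only overlap with eigenvectors of `B` with positive eigenvalue. -/
theorem eigenvalue_pos_of_eigenOverlap_ne_zero (hA : A.PosSemidef) (hB : B.IsHermitian) {c : ℝ}
    (hc : 0 < c) (hBA : (B - c • A).PosSemidef) {i j : ι}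
    (hij : eigenOverlap hA.1 hB i j * hA.1.eigenvalues i ≠ 0) :
    0 < hA.1.eigenvalues i ∧ 0 < hB.eigenvalues j := by
  have ha : 0 < hA.1.eigenvalues i :=
    lt_of_le_of_ne (hA.eigenvalues_nonneg i) (fun h => hij (by rw [← h, mul_zero]))
  refine ⟨ha, ?_⟩
  have h1 := (hBA.conjTranspose_mul_mul_same (hB.eigenvectorUnitary : Matrix ι ι ℂ)).diag_nonneg
    (i := j)
  rw [← star_eq_conjTranspose, mul_sub, sub_mul, Matrix.sub_apply, diag_eigenbasis_self,
    mul_smul_comm, smul_mul_assoc, Matrix.smul_apply] at h1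
  have h2 := (Complex.le_def.1 h1).1
  simp only [Complex.zero_re, Complex.sub_re, Complex.ofReal_re, Complex.smul_re,
    diag_eigenbasis hA.1 hB, smul_eq_mul] at h2
  have h3 : eigenOverlap hA.1 hB i j * hA.1.eigenvalues i
      ≤ ∑ i, eigenOverlap hA.1 hB i j * hA.1.eigenvalues i :=
    Finset.single_le_sum
      (f := fun i => eigenOverlap hA.1 hB i j * hA.1.eigenvalues i)
      (fun i _ => mul_nonneg (eigenOverlap_nonneg _ _ _ _) (hA.eigenvalues_nonneg i))
      (Finset.mem_univ i)
  have h4 : 0 < eigenOverlap hA.1 hB i j * hA.1.eigenvalues i :=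
    lt_of_le_of_ne (mul_nonneg (eigenOverlap_nonneg _ _ _ _) ha.le) hij.symm
  have := mul_pos hc (h4.trans_le h3)
  linarith

theorem vnEntropy_eq (hA : A.IsHermitian) :
    vnEntropy A = -∑ i, hA.eigenvalues i * Real.log (hA.eigenvalues i) := dif_pos hA

theorem trace_mul_cfc_log_self (hB : B.IsHermitian) :
    (B * cfc Real.log B).trace.re = -vnEntropy B := by
  rw [vnEntropy_eq hB, neg_neg, ← hB.trace_cfc_re (fun x => x * Real.log x)]
  congr 2
  rw [hB.cfc_eq_mul_diagonal_mul_star, hB.cfc_eq_mul_diagonal_mul_star]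
  conv_lhs =>
    enter [1]
    rw [hB.eq_mul_diagonal_mul_star]
  simp only [mul_assoc]
  rw [← mul_assoc (star (hB.eigenvectorUnitary : Matrix ι ι ℂ)), Unitary.coe_star_mul_self,
    one_mul, ← mul_assoc (diagonal _), diagonal_mul_diagonal]
  simp

/-- Relative entropy `Tr A (log A - log B)` as a double sum over the two eigenbases. -/
theorem sum_eigenOverlap_mul_log (hA : A.IsHermitian) (hB : B.IsHermitian) :
    ∑ i, ∑ j, eigenOverlap hA hB i j * hA.eigenvalues i *
      (Real.log (hA.eigenvalues i) - Real.log (hB.eigenvalues j))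
      = -vnEntropy A - (A * cfc Real.log B).trace.re := by
  simp_rw [mul_sub, Finset.sum_sub_distrib]
  congr 1
  · rw [vnEntropy_eq hA, neg_neg]
    refine Finset.sum_congr rfl fun i _ => ?_
    rw [← Finset.sum_mul, ← Finset.sum_mul, sum_eigenOverlap, one_mul]
  · rw [Finset.sum_comm, hB.cfc_eq_mul_diagonal_mul_star, ← mul_assoc, trace_mul_comm,
      ← mul_assoc, ← mul_assoc]
    rw [Matrix.trace, Complex.re_sum]
    refine Finset.sum_congr rfl fun j _ => ?_
    rw [diag_apply, mul_diagonal, Complex.re_mul_ofReal, diag_eigenbasis hA hB, Finset.sum_mul]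

theorem sum_eigenOverlap_mul_eigenvalues (hA : A.IsHermitian) (hB : B.IsHermitian) :
    ∑ i, ∑ j, eigenOverlap hA hB i j * hA.eigenvalues i = A.trace.re := by
  simp_rw [← Finset.sum_mul, sum_eigenOverlap, one_mul]
  simpa using (congrArg Complex.re hA.trace_eq_sum_eigenvalues).symm

/-- The concave quadratic functional of `Y` whose maximum is a resolvent quasi-entropy. -/
def quasiForm (A B : Matrix ι ι ℂ) (T : ℝ) (Y : Matrix ι ι ℂ) : ℝ :=
  2 * (Yᴴ * A).trace.re - (Y * Yᴴ * B).trace.re - T * (Yᴴ * Y * A).trace.re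

theorem re_trace_mul_conjTranspose_mul_diagonal (Z : Matrix ι ι ℂ) (b : ι → ℝ) :
    (Z * Zᴴ * diagonal (fun j => (b j : ℂ))).trace.re
      = ∑ i, ∑ j, Complex.normSq (Z j i) * b j := by
  rw [Finset.sum_comm, Matrix.trace, Complex.re_sum]
  refine Finset.sum_congr rfl fun j _ => ?_
  rw [diag_apply, mul_diagonal, Complex.re_mul_ofReal, Matrix.mul_apply, Complex.re_sum,
    Finset.sum_mul]
  simp [Complex.normSq_apply]

theorem quasiForm_eigenbasis (hA : A.IsHermitian) (hB : B.IsHermitian) (T : ℝ)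
    (Z : Matrix ι ι ℂ) :
    quasiForm A B T ((hB.eigenvectorUnitary : Matrix ι ι ℂ) * Z *
      star (hA.eigenvectorUnitary : Matrix ι ι ℂ))
      = ∑ i, ∑ j, (2 * (star (Z j i) * eigenTransition hA hB j i).re * hA.eigenvalues i
        - Complex.normSq (Z j i) * (hB.eigenvalues j + T * hA.eigenvalues i)) := by
  set U := (hA.eigenvectorUnitary : Matrix ι ι ℂ) with hU
  set W := (hB.eigenvectorUnitary : Matrix ι ι ℂ) with hW
  have hUU : Uᴴ * U = 1 := Unitary.coe_star_mul_self _
  have hWW : Wᴴ * W = 1 := Unitary.coe_star_mul_self _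
  have hUU' : ∀ X : Matrix ι ι ℂ, Uᴴ * (U * X) = X := fun X => by
    rw [← mul_assoc, hUU, one_mul]
  have hWW' : ∀ X : Matrix ι ι ℂ, Wᴴ * (W * X) = X := fun X => by
    rw [← mul_assoc, hWW, one_mul]
  have h1 : ((W * Z * star U)ᴴ * A).trace.re
      = ∑ i, ∑ j, (star (Z j i) * eigenTransition hA hB j i).re * hA.eigenvalues i := by
    have : ((W * Z * star U)ᴴ * A).trace
        = (Zᴴ * eigenTransition hA hB * diagonal (fun i => (hA.eigenvalues i : ℂ))).trace := by
      conv_lhs => rw [hA.eq_mul_diagonal_mul_star]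
      rw [← mul_assoc, trace_mul_comm]
      simp only [star_eq_conjTranspose, conjTranspose_mul, conjTranspose_conjTranspose, ← hU,
        mul_assoc, hUU', eigenTransition, ← hW]
    rw [this, Matrix.trace, Complex.re_sum]
    refine Finset.sum_congr rfl fun i _ => ?_
    rw [diag_apply, mul_diagonal, Complex.re_mul_ofReal, Matrix.mul_apply, Complex.re_sum,
      Finset.sum_mul]
    rfl
  have h2 : ((W * Z * star U) * (W * Z * star U)ᴴ * B).trace.re
      = ∑ i, ∑ j, Complex.normSq (Z j i) * hB.eigenvalues j := by
    rw [← re_trace_mul_conjTranspose_mul_diagonal]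
    conv_lhs => rw [hB.eq_mul_diagonal_mul_star]
    rw [← mul_assoc, trace_mul_comm]
    simp only [star_eq_conjTranspose, conjTranspose_mul, conjTranspose_conjTranspose, ← hW,
      mul_assoc, hUU', hWW']
  have h3 : ((W * Z * star U)ᴴ * (W * Z * star U) * A).trace.re
      = ∑ i, ∑ j, Complex.normSq (Z j i) * hA.eigenvalues i := by
    have := re_trace_mul_conjTranspose_mul_diagonal Zᴴ hA.eigenvalues
    rw [Finset.sum_comm] at this
    simp only [conjTranspose_apply, Complex.star_def, Complex.normSq_conj,
      conjTranspose_conjTranspose] at this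
    rw [← this]
    conv_lhs => rw [hA.eq_mul_diagonal_mul_star]
    rw [← mul_assoc, trace_mul_comm]
    simp only [star_eq_conjTranspose, conjTranspose_mul, conjTranspose_conjTranspose, ← hU,
      mul_assoc, hUU', hWW']
  rw [quasiForm, h1, h2, h3]
  simp only [Finset.mul_sum, ← Finset.sum_sub_distrib]
  refine Finset.sum_congr rfl fun i _ => Finset.sum_congr rfl fun j _ => ?_
  ring

theorem two_mul_re_sub_normSq_mul_le (z c : ℂ) {a b T : ℝ} (ha : 0 ≤ a) (hb : 0 ≤ b)
    (hT : 0 < T) :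
    2 * (star z * c).re * a - Complex.normSq z * (b + T * a)
      ≤ Complex.normSq c * a * (a / (b + T * a)) := by
  rcases (show 0 ≤ b + T * a by positivity).eq_or_lt with h | h
  · have : a = 0 := by
      by_contra h0
      have : 0 < T * a := mul_pos hT (lt_of_le_of_ne ha (Ne.symm h0))
      linarith
    have hb0 : b = 0 := by simpa [this] using h.symm
    simp [hb0, this]
  · rw [← mul_div_assoc, le_div_iff₀ h]
    generalize b + T * a = s at *
    simp only [Complex.star_def, Complex.mul_re, Complex.conj_re, Complex.conj_im,
      Complex.normSq_apply]
    nlinarith [sq_nonneg (z.re * s - c.re * a), sq_nonneg (z.im * s - c.im * a)]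

theorem quasiForm_le (hA : A.PosSemidef) (hB : B.PosSemidef) {T : ℝ} (hT : 0 < T)
    (Y : Matrix ι ι ℂ) :
    quasiForm A B T Y ≤ ∑ i, ∑ j, eigenOverlap hA.1 hB.1 i j * hA.1.eigenvalues i *
      (hA.1.eigenvalues i / (hB.1.eigenvalues j + T * hA.1.eigenvalues i)) := by
  have hY : Y = (hB.1.eigenvectorUnitary : Matrix ι ι ℂ) *
      (star (hB.1.eigenvectorUnitary : Matrix ι ι ℂ) * Y *
        (hA.1.eigenvectorUnitary : Matrix ι ι ℂ)) *
      star (hA.1.eigenvectorUnitary : Matrix ι ι ℂ) := by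
    simp only [← mul_assoc]
    rw [mul_assoc, hA.1.eigenvectorUnitary_mul_star, hB.1.eigenvectorUnitary_mul_star, one_mul,
      mul_one]
  rw [hY, quasiForm_eigenbasis]
  exact Finset.sum_le_sum fun i _ => Finset.sum_le_sum fun j _ =>
    two_mul_re_sub_normSq_mul_le _ _ (hA.eigenvalues_nonneg i) (hB.eigenvalues_nonneg j) hT

theorem exists_quasiForm_eq (hA : A.PosSemidef) (hB : B.PosSemidef) (T : ℝ) :
    ∃ Y, quasiForm A B T Y = ∑ i, ∑ j, eigenOverlap hA.1 hB.1 i j * hA.1.eigenvalues i *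
      (hA.1.eigenvalues i / (hB.1.eigenvalues j + T * hA.1.eigenvalues i)) := by
  refine ⟨_, (quasiForm_eigenbasis hA.1 hB.1 T (Matrix.of fun j i =>
    eigenTransition hA.1 hB.1 j i *
      ((hA.1.eigenvalues i / (hB.1.eigenvalues j + T * hA.1.eigenvalues i) : ℝ) : ℂ))).trans ?_⟩
  refine Finset.sum_congr rfl fun i _ => Finset.sum_congr rfl fun j _ => ?_
  have ha := hA.eigenvalues_nonneg i
  have hb := hB.eigenvalues_nonneg j
  rw [of_apply, eigenOverlap]
  generalize eigenTransition hA.1 hB.1 j i = c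
  generalize hA.1.eigenvalues i = a at *
  generalize hB.1.eigenvalues j = b at *
  rw [Complex.normSq_mul, Complex.normSq_ofReal, star_mul', Complex.star_def,
    Complex.conj_ofReal, mul_right_comm (starRingEnd ℂ c), Complex.re_mul_ofReal,
    ← Complex.normSq_eq_conj_mul_self,
    Complex.ofReal_re]
  by_cases hs : b + T * a = 0
  · simp [hs]
  · field_simp
    ring

end Hermitian

open MatrixOrder in
theorem re_trace_mul_nonneg {ι : Type*} [Fintype ι] [DecidableEq ι] {P Q : Matrix ι ι ℂ}
    (hP : P.PosSemidef) (hQ : Q.PosSemidef) : 0 ≤ (P * Q).trace.re := by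
  obtain ⟨R, rfl⟩ := CStarAlgebra.nonneg_iff_eq_star_mul_self.1 hP.nonneg
  rw [mul_assoc, trace_mul_comm]
  exact (Complex.le_def.1 (hQ.mul_mul_conjTranspose_same R).trace_nonneg).1

section Channel

variable {n m : ℕ} {Ω K : Type*} [Fintype K]
  {V : Ω → K → Matrix (Fin m) (Fin n) ℂ}

theorem instAct_add (ω : Ω) (X Y : Matrix (Fin n) (Fin n) ℂ) :
    instAct V ω (X + Y) = instAct V ω X + instAct V ω Y := by
  simp [instAct, Matrix.mul_add, Matrix.add_mul, Finset.sum_add_distrib]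

theorem instAct_smul (ω : Ω) (c : ℝ) (X : Matrix (Fin n) (Fin n) ℂ) :
    instAct V ω (c • X) = c • instAct V ω X := by
  simp [instAct, Finset.smul_sum]

theorem instAct_sum {A : Type*} [Fintype A] (ω : Ω) (X : A → Matrix (Fin n) (Fin n) ℂ) :
    instAct V ω (∑ α, X α) = ∑ α, instAct V ω (X α) := by
  simp_rw [instAct, Matrix.mul_sum, Matrix.sum_mul]
  exact Finset.sum_comm

theorem instAct_posSemidef (ω : Ω) {X : Matrix (Fin n) (Fin n) ℂ} (hX : X.PosSemidef) :
    (instAct V ω X).PosSemidef :=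
  posSemidef_sum _ fun k _ => hX.mul_mul_conjTranspose_same (V ω k)

theorem probOut_sum {A : Type*} [Fintype A] (p : A → ℝ) (ρ : A → Matrix (Fin n) (Fin n) ℂ)
    (ω : Ω) : probOut V (∑ α, p α • ρ α) ω = ∑ α, p α * probOut V (ρ α) ω := by
  simp [probOut, Matrix.mul_sum, trace_sum, Complex.re_sum, Matrix.trace_smul]

theorem trace_instAct (ω : Ω) (X : Matrix (Fin n) (Fin n) ℂ) :
    (instAct V ω X).trace = (povm V ω * X).trace := by
  simp_rw [instAct, povm, Matrix.sum_mul, trace_sum]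
  refine Finset.sum_congr rfl fun k _ => ?_
  rw [trace_mul_comm, ← Matrix.mul_assoc]

theorem probOut_nonneg {ρ : Matrix (Fin n) (Fin n) ℂ} (hρ : ρ.PosSemidef) (ω : Ω) :
    0 ≤ probOut V ρ ω := by
  rw [probOut, ← trace_instAct]
  exact (Complex.le_def.1 (instAct_posSemidef ω hρ).trace_nonneg).1

variable [Fintype Ω]

theorem sum_trace_instAct (hV : ∑ ω, ∑ k, (V ω k)ᴴ * V ω k = 1)
    (X : Matrix (Fin n) (Fin n) ℂ) : ∑ ω, (instAct V ω X).trace = X.trace := by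
  simp_rw [trace_instAct, ← trace_sum, ← Matrix.sum_mul, povm, hV, one_mul]

/-- The Heisenberg-picture (dual) map of an instrument. -/
def dualAct (V : Ω → K → Matrix (Fin m) (Fin n) ℂ) (Y : Ω → Matrix (Fin m) (Fin m) ℂ) :
    Matrix (Fin n) (Fin n) ℂ :=
  ∑ ω, ∑ k, (V ω k)ᴴ * Y ω * V ω k

theorem conjTranspose_dualAct (Y : Ω → Matrix (Fin m) (Fin m) ℂ) :
    (dualAct V Y)ᴴ = dualAct V (fun ω => (Y ω)ᴴ) := by
  simp [dualAct, conjTranspose_sum, Matrix.mul_assoc]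

theorem trace_dualAct_mul (Y : Ω → Matrix (Fin m) (Fin m) ℂ) (X : Matrix (Fin n) (Fin n) ℂ) :
    (dualAct V Y * X).trace = ∑ ω, (Y ω * instAct V ω X).trace := by
  simp_rw [dualAct, instAct, Matrix.sum_mul, trace_sum, Matrix.mul_sum, trace_sum]
  refine Finset.sum_congr rfl fun ω _ => Finset.sum_congr rfl fun k _ => ?_
  rw [Matrix.mul_assoc, Matrix.mul_assoc, trace_mul_comm]
  simp only [Matrix.mul_assoc]

/-- **Kadison–Schwarz inequality** for the dual map of an instrument. -/
theorem dualAct_schwarz (hV : ∑ ω, ∑ k, (V ω k)ᴴ * V ω k = 1)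
    (Y : Ω → Matrix (Fin m) (Fin m) ℂ) :
    (dualAct V (fun ω => (Y ω)ᴴ * Y ω) - (dualAct V Y)ᴴ * dualAct V Y).PosSemidef := by
  have h : dualAct V (fun ω => (Y ω)ᴴ * Y ω) - (dualAct V Y)ᴴ * dualAct V Y
      = ∑ ω, ∑ k, (Y ω * V ω k - V ω k * dualAct V Y)ᴴ *
          (Y ω * V ω k - V ω k * dualAct V Y) := by
    set S := dualAct V Y with hS
    have e : ∀ ω k, (Y ω * V ω k - V ω k * S)ᴴ * (Y ω * V ω k - V ω k * S)
        = (V ω k)ᴴ * ((Y ω)ᴴ * Y ω) * V ω k - ((V ω k)ᴴ * (Y ω)ᴴ * V ω k) * S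
          - Sᴴ * ((V ω k)ᴴ * Y ω * V ω k) + Sᴴ * ((V ω k)ᴴ * V ω k) * S := by
      intro ω k
      simp only [conjTranspose_sub, conjTranspose_mul, Matrix.sub_mul, Matrix.mul_sub,
        Matrix.mul_assoc]
      abel
    simp_rw [e, Finset.sum_add_distrib, Finset.sum_sub_distrib, ← Matrix.sum_mul,
      ← Matrix.mul_sum, hV]
    have e1 : ∑ ω, ∑ k, (V ω k)ᴴ * (Y ω)ᴴ * V ω k = Sᴴ := by
      rw [hS, conjTranspose_dualAct]; rfl
    have e2 : ∑ ω, ∑ k, (V ω k)ᴴ * Y ω * V ω k = S := rfl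
    rw [e1, e2, mul_one, sub_add_cancel]
    rfl
  rw [h]
  exact posSemidef_sum _ fun ω _ => posSemidef_sum _ fun k _ =>
    posSemidef_conjTranspose_mul_self _

theorem re_trace_dualAct_le (hV : ∑ ω, ∑ k, (V ω k)ᴴ * V ω k = 1)
    (Y : Ω → Matrix (Fin m) (Fin m) ℂ) {X : Matrix (Fin n) (Fin n) ℂ} (hX : X.PosSemidef) :
    ((dualAct V Y)ᴴ * dualAct V Y * X).trace.re
      ≤ ∑ ω, ((Y ω)ᴴ * Y ω * instAct V ω X).trace.re := by
  have h := re_trace_mul_nonneg (dualAct_schwarz hV Y) hX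
  rw [Matrix.sub_mul, trace_sub, Complex.sub_re, trace_dualAct_mul, Complex.re_sum] at h
  linarith

theorem sum_quasiForm_instAct_le (hV : ∑ ω, ∑ k, (V ω k)ᴴ * V ω k = 1)
    {X Z : Matrix (Fin n) (Fin n) ℂ} (hX : X.PosSemidef) (hZ : Z.PosSemidef) {T : ℝ}
    (hT : 0 < T) (Y : Ω → Matrix (Fin m) (Fin m) ℂ) :
    ∑ ω, quasiForm (instAct V ω X) (instAct V ω Z) T (Y ω) ≤ quasiForm X Z T (dualAct V Y) := by
  have h1 : ((dualAct V Y)ᴴ * X).trace.re = ∑ ω, ((Y ω)ᴴ * instAct V ω X).trace.re := by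
    rw [conjTranspose_dualAct, trace_dualAct_mul, Complex.re_sum]
  have h2 := re_trace_dualAct_le hV (fun ω => (Y ω)ᴴ) hZ
  have h3 := re_trace_dualAct_le hV Y hX
  simp only [← conjTranspose_dualAct, conjTranspose_conjTranspose] at h2
  simp only [quasiForm, Finset.sum_sub_distrib, ← Finset.mul_sum]
  rw [h1]
  nlinarith

/-- **Monotonicity of the quantum relative entropy** under an instrument. -/
theorem sum_relativeEntropy_instAct_le (hV : ∑ ω, ∑ k, (V ω k)ᴴ * V ω k = 1)
    {X Z : Matrix (Fin n) (Fin n) ℂ} (hX : X.PosSemidef) (hZ : Z.PosSemidef) {c : ℝ}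
    (hc : 0 < c) (hXZ : (Z - c • X).PosSemidef) :
    ∑ ω, (-vnEntropy (instAct V ω X) - (instAct V ω X * cfc Real.log (instAct V ω Z)).trace.re)
      ≤ -vnEntropy X - (X * cfc Real.log Z).trace.re := by
  have hX' : ∀ ω, (instAct V ω X).PosSemidef := fun ω => instAct_posSemidef ω hX
  have hZ' : ∀ ω, (instAct V ω Z).PosSemidef := fun ω => instAct_posSemidef ω hZ
  have hXZ' : ∀ ω, (instAct V ω Z - c • instAct V ω X).PosSemidef := fun ω => by
    have := instAct_posSemidef (V := V) ω hXZ
    rwa [sub_eq_add_neg, ← neg_smul, instAct_add, instAct_smul, neg_smul, ← sub_eq_add_neg] at this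
  have key := sum_mul_log_sub_log_nonneg
    (ι := (Fin n × Fin n) ⊕ (Ω × Fin m × Fin m))
    (Sum.elim (fun x => eigenOverlap hX.1 hZ.1 x.1 x.2 * hX.1.eigenvalues x.1)
      (fun x => -(eigenOverlap (hX' x.1).1 (hZ' x.1).1 x.2.1 x.2.2 *
        (hX' x.1).1.eigenvalues x.2.1)))
    (Sum.elim (fun x => hX.1.eigenvalues x.1) (fun x => (hX' x.1).1.eigenvalues x.2.1))
    (Sum.elim (fun x => hZ.1.eigenvalues x.2) (fun x => (hZ' x.1).1.eigenvalues x.2.2))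
  simp only [Fintype.sum_sum_type, Sum.elim_inl, Sum.elim_inr, Fintype.sum_prod_type, neg_mul,
    Finset.sum_neg_distrib, sum_eigenOverlap_mul_log, sum_eigenOverlap_mul_eigenvalues] at key
  have hlog := fun ω => sum_eigenOverlap_mul_log (hX' ω).1 (hZ' ω).1
  have htr := fun ω => sum_eigenOverlap_mul_eigenvalues (hX' ω).1 (hZ' ω).1
  simp_rw [← hlog]
  rw [← sub_nonneg, sub_eq_add_neg]
  refine key ?_ ?_ ?_
  · simp_rw [htr]
    rw [← Complex.re_sum, sum_trace_instAct hV, add_neg_cancel]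
  · rintro (⟨i, j⟩ | ⟨ω, i, j⟩) h
    · exact eigenvalue_pos_of_eigenOverlap_ne_zero hX hZ.1 hc hXZ h
    · exact eigenvalue_pos_of_eigenOverlap_ne_zero (hX' ω) (hZ' ω).1 hc (hXZ' ω)
        (neg_ne_zero.1 h)
  · intro T hT
    choose Y hY using fun ω => exists_quasiForm_eq (hX' ω) (hZ' ω) T
    have h1 := sum_quasiForm_instAct_le hV hX hZ hT Y
    have h2 := quasiForm_le hX hZ hT (dualAct V Y)
    simp_rw [hY] at h1
    linarith

/-- Concavity of the entropy difference `S(ρ) - ∑ ω, S(I_ω(ρ))`. -/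
theorem sum_mul_entropy_sub_le {A : Type*} [Fintype A]
    (hV : ∑ ω, ∑ k, (V ω k)ᴴ * V ω k = 1) {p : A → ℝ} (hp0 : ∀ α, 0 ≤ p α)
    {ρ : A → Matrix (Fin n) (Fin n) ℂ} (hρ : ∀ α, (ρ α).PosSemidef) :
    ∑ α, p α * (vnEntropy (ρ α) - ∑ ω, vnEntropy (instAct V ω (ρ α)))
      ≤ vnEntropy (∑ α, p α • ρ α) - ∑ ω, vnEntropy (instAct V ω (∑ α, p α • ρ α)) := by
  classical
  set η := ∑ α, p α • ρ α with hη
  have hηp : η.PosSemidef := posSemidef_sum _ fun α _ => (hρ α).smul (hp0 α)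
  have hdom : ∀ α, (η - p α • ρ α).PosSemidef := fun α => by
    rw [hη, ← Finset.add_sum_erase _ _ (Finset.mem_univ α), add_sub_cancel_left]
    exact posSemidef_sum _ fun β _ => (hρ β).smul (hp0 β)
  have hstep : ∀ α, p α * ∑ ω, (-vnEntropy (instAct V ω (ρ α))
        - (instAct V ω (ρ α) * cfc Real.log (instAct V ω η)).trace.re)
      ≤ p α * (-vnEntropy (ρ α) - (ρ α * cfc Real.log η).trace.re) := fun α => by
    rcases (hp0 α).eq_or_lt with h | h
    · simp [← h]
    · exact mul_le_mul_of_nonneg_left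
        (sum_relativeEntropy_instAct_le hV (hρ α) hηp h (hdom α)) h.le
  have hsum := Finset.sum_le_sum fun α (_ : α ∈ Finset.univ) => hstep α
  have hlin : ∀ {d : ℕ} (X : A → Matrix (Fin d) (Fin d) ℂ) (L : Matrix (Fin d) (Fin d) ℂ),
      ∑ α, p α * (X α * L).trace.re = ((∑ α, p α • X α) * L).trace.re := by
    intro d X L
    simp [Matrix.sum_mul, trace_sum, Complex.re_sum, Matrix.trace_smul]
  have e1 : ∑ α, p α * (ρ α * cfc Real.log η).trace.re = -vnEntropy η := by
    rw [hlin, ← hη, trace_mul_cfc_log_self hηp.1]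
  have e2 : ∀ ω, ∑ α, p α * (instAct V ω (ρ α) * cfc Real.log (instAct V ω η)).trace.re
      = -vnEntropy (instAct V ω η) := fun ω => by
    rw [hlin, ← trace_mul_cfc_log_self (instAct_posSemidef ω hηp).1]
    congr 3
    simp_rw [hη, instAct_sum, instAct_smul]
  have e3 : ∑ α, p α * ∑ ω, (instAct V ω (ρ α) * cfc Real.log (instAct V ω η)).trace.re
      = -∑ ω, vnEntropy (instAct V ω η) := by
    simp_rw [Finset.mul_sum]
    rw [Finset.sum_comm]
    simp_rw [e2, Finset.sum_neg_distrib]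
  simp only [mul_sub, mul_neg, Finset.sum_sub_distrib, Finset.sum_neg_distrib] at hsum ⊢
  linarith

theorem mul_vnEntropy_inv_smul {ι : Type*} [Fintype ι] [DecidableEq ι] {X : Matrix ι ι ℂ}
    (hX : X.PosSemidef) (ht : 0 < X.trace.re) :
    X.trace.re * vnEntropy ((X.trace.re)⁻¹ • X)
      = vnEntropy X + X.trace.re * Real.log X.trace.re := by
  have htr : X.trace.re = ∑ i, hX.1.eigenvalues i := by
    simpa using congrArg Complex.re hX.1.trace_eq_sum_eigenvalues
  generalize hs : X.trace.re = t at *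
  have hXc : (t⁻¹ • X).PosSemidef := hX.smul (by positivity)
  have hcont : Continuous fun x : ℝ => x * Real.log x := Real.continuous_mul_log
  have hcfc : cfc (fun x : ℝ => x * Real.log x) (t⁻¹ • X)
      = cfc (fun x : ℝ => t⁻¹ * x * Real.log (t⁻¹ * x)) X :=
    (cfc_comp_const_mul t⁻¹ (fun x : ℝ => x * Real.log x) X hcont.continuousOn hX.1).symm
  rw [vnEntropy_eq hXc.1, vnEntropy_eq hX.1, ← hXc.1.trace_cfc_re (fun x => x * Real.log x),
    hcfc, hX.1.trace_cfc_re]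
  have h : ∀ i, t * (t⁻¹ * hX.1.eigenvalues i * Real.log (t⁻¹ * hX.1.eigenvalues i))
      = hX.1.eigenvalues i * Real.log (hX.1.eigenvalues i)
        - hX.1.eigenvalues i * Real.log t := by
    intro i
    rcases (hX.eigenvalues_nonneg i).eq_or_lt with h | h
    · simp [← h]
    · rw [Real.log_mul (by positivity) h.ne', Real.log_inv]
      field_simp
      ring
  rw [mul_neg, Finset.mul_sum]
  simp_rw [h]
  rw [Finset.sum_sub_distrib, ← Finset.sum_mul, ← htr]
  ring

theorem infoGain_eq {ρ : Matrix (Fin n) (Fin n) ℂ} (hρ : ρ.PosSemidef) :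
    infoGain V ρ = vnEntropy ρ - ∑ ω, vnEntropy (instAct V ω ρ)
      - ∑ ω, probOut V ρ ω * Real.log (probOut V ρ ω) := by
  rw [infoGain, sub_sub, ← Finset.sum_add_distrib]
  congr 1
  refine Finset.sum_congr rfl fun ω _ => ?_
  have hX := instAct_posSemidef (V := V) ω hρ
  rw [probOut, ← trace_instAct]
  split_ifs with h
  · exact mul_vnEntropy_inv_smul hX h
  · have h0 := Complex.le_def.1 hX.trace_nonneg
    have h1 : (instAct V ω ρ).trace.re = 0 := le_antisymm (not_lt.1 h) h0.1
    have h2 : (instAct V ω ρ).trace = 0 := Complex.ext h1 h0.2.symm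
    rw [hX.trace_eq_zero_iff] at h2
    have h3 : vnEntropy (0 : Matrix (Fin m) (Fin m) ℂ) = 0 := by
      have hz : (0 : Matrix (Fin m) (Fin m) ℂ).IsHermitian := isHermitian_zero
      rw [vnEntropy_eq hz, hz.eigenvalues_eq_zero_iff.2 rfl]
      simp
    simp [h2, h3]

theorem Ic_eq {A : Type*} [Fintype A] {p : A → ℝ} (hp0 : ∀ α, 0 ≤ p α)
    {ρ : A → Matrix (Fin n) (Fin n) ℂ} (hρ : ∀ α, (ρ α).PosSemidef) :
    Ic p ρ V = ∑ α, p α * ∑ ω, probOut V (ρ α) ω * Real.log (probOut V (ρ α) ω)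
      - ∑ ω, probOut V (∑ α, p α • ρ α) ω * Real.log (probOut V (∑ α, p α • ρ α) ω) := by
  have h : ∀ α ω, (if 0 < p α * probOut V (ρ α) ω then
      p α * probOut V (ρ α) ω * Real.log ((p α * probOut V (ρ α) ω) /
        (p α * probOut V (∑ β, p β • ρ β) ω)) else 0)
      = p α * (probOut V (ρ α) ω * Real.log (probOut V (ρ α) ω))
        - p α * probOut V (ρ α) ω * Real.log (probOut V (∑ β, p β • ρ β) ω) := by
    intro α ω
    have hP := probOut_nonneg (V := V) (hρ α) ω
    split_ifs with h
    · have hp : p α ≠ 0 := fun h0 => by simp [h0] at h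
      have hP' : probOut V (ρ α) ω ≠ 0 := fun h0 => by simp [h0] at h
      have hle : p α * probOut V (ρ α) ω ≤ probOut V (∑ β, p β • ρ β) ω := by
        rw [probOut_sum]
        exact Finset.single_le_sum (f := fun α => p α * probOut V (ρ α) ω)
          (fun β _ => mul_nonneg (hp0 β) (probOut_nonneg (hρ β) ω)) (Finset.mem_univ α)
      rw [mul_div_mul_left _ _ hp, Real.log_div hP' (h.trans_le hle).ne']
      ring
    · have h0 : p α * probOut V (ρ α) ω = 0 := le_antisymm (not_lt.1 h) (mul_nonneg (hp0 α) hP)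
      rw [← mul_assoc, h0]
      simp
  simp_rw [Ic, h, Finset.sum_sub_distrib, ← Finset.mul_sum]
  congr 1
  rw [Finset.sum_comm]
  refine Finset.sum_congr rfl fun ω _ => ?_
  rw [← Finset.sum_mul, probOut_sum]

end Channel

theorem SWW_information_gain_form {A Ω K : Type*} [Fintype A] [Fintype Ω] [Fintype K]
    [Nonempty A] [Nonempty Ω] [Nonempty K] {n m : ℕ} (hn : 1 ≤ n) (hm : 1 ≤ m)
    (p : A → ℝ) (hp0 : ∀ α, 0 ≤ p α) (hp1 : ∑ α, p α = 1)
    (ρ : A → Matrix (Fin n) (Fin n) ℂ) (hρ : ∀ α, IsDensityMatrix (ρ α))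
    (V : Ω → K → Matrix (Fin m) (Fin n) ℂ)
    (hV : ∑ ω, ∑ k, (V ω k)ᴴ * V ω k = 1)
    (η : Matrix (Fin n) (Fin n) ℂ) (hη : η = ∑ α, p α • ρ α) :
    infoGain V η ≥
      Ic p ρ V + ∑ α, (if 0 < p α then p α * infoGain V (ρ α) else 0) := by
  subst hη
  have hρ' : ∀ α, (ρ α).PosSemidef := fun α => (hρ α).1
  have hif : ∀ α, (if 0 < p α then p α * infoGain V (ρ α) else 0) = p α * infoGain V (ρ α) := by
    intro α
    split_ifs with h
    · rfl
    · rw [le_antisymm (not_lt.1 h) (hp0 α), zero_mul]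
  have hmain := sum_mul_entropy_sub_le hV hp0 hρ'
  simp_rw [hif, infoGain_eq (hρ' _)]
  rw [infoGain_eq (posSemidef_sum _ fun α _ => (hρ' α).smul (hp0 α)), Ic_eq hp0 hρ']
  have hsplit : ∑ α, p α * (vnEntropy (ρ α) - ∑ ω, vnEntropy (instAct V ω (ρ α))
        - ∑ ω, probOut V (ρ α) ω * Real.log (probOut V (ρ α) ω))
      = ∑ α, p α * (vnEntropy (ρ α) - ∑ ω, vnEntropy (instAct V ω (ρ α)))
        - ∑ α, p α * ∑ ω, probOut V (ρ α) ω * Real.log (probOut V (ρ α) ω) := by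
    rw [← Finset.sum_sub_distrib]
    exact Finset.sum_congr rfl fun α _ => mul_sub _ _ _
  rw [hsplit]
  linarith

end
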